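/- arXiv:1612.08085 — 5 statements merged into one kernel-verified Lean document; each statement's English description precedes it below -/
import Mathlib

section
/- Let R be a ring with identity, and let (a,b) and (a',b') be two admissible pairs in R × R. Then the left R-submodules of R² generated by (a,b) and by (a',b') coincide if and only if there exists a unit u of R with (a,b) = (u·a', u·b'). -/
/-- A pair is admissible if it is the first row of some invertible 2×2 matrix. -/
def Admissible (R : Type*) [Ring R] (v : R × R) : Prop :=
  ∃ M : Matrix (Fin 2) (Fin 2) R, IsUnit M ∧ M 0 0 = v.1 ∧ M 0 1 = v.2

theorem Admissible.exists_mul_add_mul_eq_one {R : Type*} [Ring R] {a b : R}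
    (h : Admissible R (a, b)) : ∃ x y : R, a * x + b * y = 1 := by
  obtain ⟨M, hM, h0, h1⟩ := h
  obtain ⟨N, hN⟩ := hM.exists_right_inv
  refine ⟨N 0 0, N 1 0, ?_⟩
  have := congrFun (congrFun hN 0) 0
  simpa [Matrix.mul_apply, Fin.sum_univ_two, h0, h1] using this

/-- An element fixing both entries of an admissible pair is `1`. -/
theorem Admissible.eq_one_of_mul_eq {R : Type*} [Ring R] {a b t : R}
    (h : Admissible R (a, b)) (ha : t * a = a) (hb : t * b = b) : t = 1 := by
  obtain ⟨x, y, hxy⟩ := h.exists_mul_add_mul_eq_one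
  calc t = t * (a * x + b * y) := by rw [hxy, mul_one]
    _ = (t * a) * x + (t * b) * y := by rw [mul_add, mul_assoc, mul_assoc]
    _ = 1 := by rw [ha, hb, hxy]

/-- Two admissible pairs generate the same left `R`-submodule of `R²` iff they differ by
left multiplication by a unit. -/
theorem admissible_span_eq_iff_unit (R : Type*) [Ring R] (a b a' b' : R)
    (h : Admissible R (a, b)) (h' : Admissible R (a', b')) :
    Submodule.span R {((a, b) : R × R)} = Submodule.span R {((a', b') : R × R)} ↔
      ∃ u : Rˣ, a = (u : R) * a' ∧ b = (u : R) * b' := by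
  constructor
  · intro hspan
    have hmem : (a, b) ∈ Submodule.span R {((a', b') : R × R)} :=
      hspan ▸ Submodule.mem_span_singleton_self _
    have hmem' : (a', b') ∈ Submodule.span R {((a, b) : R × R)} :=
      hspan ▸ Submodule.mem_span_singleton_self _
    obtain ⟨r, hr⟩ := Submodule.mem_span_singleton.mp hmem
    obtain ⟨s, hs⟩ := Submodule.mem_span_singleton.mp hmem'
    simp only [Prod.smul_mk, smul_eq_mul, Prod.mk.injEq] at hr hs
    obtain ⟨hra, hrb⟩ := hr
    obtain ⟨hsa, hsb⟩ := hs
    have hrs : r * s = 1 :=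
      h.eq_one_of_mul_eq (by rw [mul_assoc, hsa, hra]) (by rw [mul_assoc, hsb, hrb])
    have hsr : s * r = 1 :=
      h'.eq_one_of_mul_eq (by rw [mul_assoc, hra, hsa]) (by rw [mul_assoc, hrb, hsb])
    exact ⟨⟨r, s, hrs, hsr⟩, hra.symm, hrb.symm⟩
  · rintro ⟨u, rfl, rfl⟩
    exact Submodule.span_singleton_group_smul_eq R u ((a', b') : R × R)
end

section
/- Let R₁ and R₂ be nontrivial rings with identity. Then the distant graph of the product ring R₁ × R₂ is isomorphic to the tensor product of the distant graph of R₁ and the distant graph of R₂; concretely, there is a bijection from P(R₁ × R₂) to P(R₁) × P(R₂) (induced by taking componentwise admissible pairs) under which two points of P(R₁ × R₂) are distant if and only if both of their first components are distant in P(R₁) and their second components are distant in P(R₂). -/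
/-- The type of admissible pairs. -/
def AdmissiblePair (R : Type*) [Ring R] := {v : R × R // Admissible R v}

/-- Two admissible pairs are associated if one is obtained from the other by left
multiplication by a unit. -/
def ProjAssoc (R : Type*) [Ring R] (v w : AdmissiblePair R) : Prop :=
  ∃ u : Rˣ, v.1.1 = (u : R) * w.1.1 ∧ v.1.2 = (u : R) * w.1.2

/-- The projective line over a ring: admissible pairs modulo unit multiples. -/
def ProjLine (R : Type*) [Ring R] := Quot (ProjAssoc R)

/-- The point of the projective line determined by an admissible pair. -/
def ProjLine.mk (R : Type*) [Ring R] (v : AdmissiblePair R) : ProjLine R :=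
  Quot.mk (ProjAssoc R) v

/-- Two points are distant if (for some, equivalently any, representatives) the 2×2 matrix
formed from the representatives is invertible. -/
def Distant (R : Type*) [Ring R] (x y : ProjLine R) : Prop :=
  ∃ (a b c d : R) (h₁ : Admissible R (a, b)) (h₂ : Admissible R (c, d)),
    x = ProjLine.mk R ⟨(a, b), h₁⟩ ∧ y = ProjLine.mk R ⟨(c, d), h₂⟩ ∧
    IsUnit !![a, b; c, d]


theorem Matrix.isUnit_prod_iff {n R S : Type*} [Fintype n] [DecidableEq n] [Ring R] [Ring S]
    {M : Matrix n n (R × S)} :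
    IsUnit M ↔ IsUnit (M.map Prod.fst) ∧ IsUnit (M.map Prod.snd) := by
  refine ⟨fun h => ⟨h.map (RingHom.fst R S).mapMatrix, h.map (RingHom.snd R S).mapMatrix⟩, ?_⟩
  rintro ⟨h₁, h₂⟩
  obtain ⟨A, hA, hA'⟩ := isUnit_iff_exists.1 h₁
  obtain ⟨B, hB, hB'⟩ := isUnit_iff_exists.1 h₂
  refine isUnit_iff_exists.2 ⟨Matrix.of fun i j => (A i j, B i j), ?_, ?_⟩
  · ext i j
    · simpa [Matrix.mul_apply, Matrix.one_apply, Prod.fst_sum, apply_ite Prod.fst] using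
        congrFun (congrFun hA i) j
    · simpa [Matrix.mul_apply, Matrix.one_apply, Prod.snd_sum, apply_ite Prod.snd] using
        congrFun (congrFun hB i) j
  · ext i j
    · simpa [Matrix.mul_apply, Matrix.one_apply, Prod.fst_sum, apply_ite Prod.fst] using
        congrFun (congrFun hA' i) j
    · simpa [Matrix.mul_apply, Matrix.one_apply, Prod.snd_sum, apply_ite Prod.snd] using
        congrFun (congrFun hB' i) j

theorem isUnit_fin_two_prod_iff {R S : Type*} [Ring R] [Ring S] {a b c d : R × S} :
    IsUnit !![a, b; c, d] ↔
      IsUnit !![a.1, b.1; c.1, d.1] ∧ IsUnit !![a.2, b.2; c.2, d.2] := by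
  rw [Matrix.isUnit_prod_iff]
  rw [Matrix.eta_fin_two (Matrix.map _ Prod.fst), Matrix.eta_fin_two (Matrix.map _ Prod.snd)]
  rfl

theorem admissible_iff {R : Type*} [Ring R] {a b : R} :
    Admissible R (a, b) ↔ ∃ c d : R, IsUnit !![a, b; c, d] := by
  constructor
  · rintro ⟨M, hM, rfl, rfl⟩
    exact ⟨M 1 0, M 1 1, by rwa [← Matrix.eta_fin_two M]⟩
  · rintro ⟨c, d, h⟩
    exact ⟨_, h, rfl, rfl⟩

theorem admissible_prod_iff {R S : Type*} [Ring R] [Ring S] {a b : R × S} :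
    Admissible (R × S) (a, b) ↔ Admissible R (a.1, b.1) ∧ Admissible S (a.2, b.2) := by
  simp only [admissible_iff, isUnit_fin_two_prod_iff]
  constructor
  · rintro ⟨c, d, h₁, h₂⟩
    exact ⟨⟨_, _, h₁⟩, ⟨_, _, h₂⟩⟩
  · rintro ⟨⟨c₁, d₁, h₁⟩, ⟨c₂, d₂, h₂⟩⟩
    exact ⟨(c₁, c₂), (d₁, d₂), h₁, h₂⟩

/-- Componentwise projections identify admissible pairs over `R × S` with pairs of admissible
pairs over `R` and `S`. -/
def AdmissiblePair.prodEquiv (R S : Type*) [Ring R] [Ring S] :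
    AdmissiblePair (R × S) ≃ AdmissiblePair R × AdmissiblePair S where
  toFun v := (⟨(v.1.1.1, v.1.2.1), (admissible_prod_iff.1 v.2).1⟩,
    ⟨(v.1.1.2, v.1.2.2), (admissible_prod_iff.1 v.2).2⟩)
  invFun p := ⟨((p.1.1.1, p.2.1.1), (p.1.1.2, p.2.1.2)), admissible_prod_iff.2 ⟨p.1.2, p.2.2⟩⟩

/-- The projective line over `R × S` is the product of the projective lines over `R` and `S`. -/
def ProjLine.prodEquiv (R S : Type*) [Ring R] [Ring S] :
    ProjLine (R × S) ≃ ProjLine R × ProjLine S where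
  toFun := Quot.lift
    (fun v => (ProjLine.mk R (AdmissiblePair.prodEquiv R S v).1,
      ProjLine.mk S (AdmissiblePair.prodEquiv R S v).2)) <| by
    rintro v w ⟨u, h₁, h₂⟩
    exact Prod.ext
      (Quot.sound ⟨Units.map (MonoidHom.fst R S) u, congrArg Prod.fst h₁, congrArg Prod.fst h₂⟩)
      (Quot.sound ⟨Units.map (MonoidHom.snd R S) u, congrArg Prod.snd h₁, congrArg Prod.snd h₂⟩)
  invFun p := Quot.lift₂
    (fun v w => ProjLine.mk (R × S) ((AdmissiblePair.prodEquiv R S).symm (v, w)))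
    (by
      rintro v w w' ⟨u, h₁, h₂⟩
      exact Quot.sound ⟨MulEquiv.prodUnits.symm (1, u),
        Prod.ext (one_mul _).symm h₁, Prod.ext (one_mul _).symm h₂⟩)
    (by
      rintro v v' w ⟨u, h₁, h₂⟩
      exact Quot.sound ⟨MulEquiv.prodUnits.symm (u, 1),
        Prod.ext h₁ (one_mul _).symm, Prod.ext h₂ (one_mul _).symm⟩) p.1 p.2
  left_inv := by
    rintro ⟨v⟩
    rfl
  right_inv := by
    rintro ⟨⟨v⟩, ⟨w⟩⟩
    rfl

/-- The distant graph of a direct product of rings is the tensor product of the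
distant graphs of the factors. -/
theorem projLine_prod_equiv (R₁ R₂ : Type*) [Ring R₁] [Ring R₂]
    [Nontrivial R₁] [Nontrivial R₂] :
    ∃ e : ProjLine (R₁ × R₂) ≃ ProjLine R₁ × ProjLine R₂,
      (∀ (a₁ b₁ : R₁) (a₂ b₂ : R₂)
          (h : Admissible (R₁ × R₂) ((a₁, a₂), (b₁, b₂)))
          (h₁ : Admissible R₁ (a₁, b₁)) (h₂ : Admissible R₂ (a₂, b₂)),
          e (ProjLine.mk _ ⟨((a₁, a₂), (b₁, b₂)), h⟩) =
            (ProjLine.mk R₁ ⟨(a₁, b₁), h₁⟩, ProjLine.mk R₂ ⟨(a₂, b₂), h₂⟩)) ∧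
      (∀ x y : ProjLine (R₁ × R₂),
          Distant (R₁ × R₂) x y ↔
            Distant R₁ (e x).1 (e y).1 ∧ Distant R₂ (e x).2 (e y).2) := by
  refine ⟨ProjLine.prodEquiv R₁ R₂, fun _ _ _ _ _ _ _ => rfl, fun x y => ⟨?_, ?_⟩⟩
  · rintro ⟨a, b, c, d, h, h', rfl, rfl, hu⟩
    obtain ⟨hu₁, hu₂⟩ := isUnit_fin_two_prod_iff.1 hu
    exact ⟨⟨_, _, _, _, _, _, rfl, rfl, hu₁⟩, ⟨_, _, _, _, _, _, rfl, rfl, hu₂⟩⟩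
  · rintro ⟨⟨a₁, b₁, c₁, d₁, h₁, h₁', hx₁, hy₁, hu₁⟩, ⟨a₂, b₂, c₂, d₂, h₂, h₂', hx₂, hy₂, hu₂⟩⟩
    exact ⟨(a₁, a₂), (b₁, b₂), (c₁, c₂), (d₁, d₂),
      admissible_prod_iff.2 ⟨h₁, h₂⟩, admissible_prod_iff.2 ⟨h₁', h₂'⟩,
      (ProjLine.prodEquiv R₁ R₂).injective (Prod.ext hx₁ hx₂),
      (ProjLine.prodEquiv R₁ R₂).injective (Prod.ext hy₁ hy₂),
      isUnit_fin_two_prod_iff.2 ⟨hu₁, hu₂⟩⟩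
end

section
/- Let R be a finite local ring with Jacobson radical J. Then the relation on P(R) given by 'equal or not distant' is an equivalence relation, it has exactly |R|/|J| + 1 equivalence classes, and every equivalence class has exactly |J| elements. (Equivalently, the complement of the distant graph of R is a disjoint union of |R|/|J| + 1 copies of the complete graph on |J| vertices.) -/
section LocalRing

variable {R : Type*} [Ring R]

theorem mem_jacobson_bot_iff_not_isUnit [Finite R] [IsLocalRing R] {x : R} :
    x ∈ Ideal.jacobson (⊥ : Ideal R) ↔ ¬ IsUnit x := by
  rw [Ideal.mem_jacobson_iff]
  constructor
  · rintro h ⟨u, rfl⟩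
    obtain ⟨z, hz⟩ := h (-(↑u⁻¹ : R))
    simp [mul_assoc] at hz
  · intro hx y
    have hyx : ¬ IsUnit (-(y * x)) := by
      rw [IsUnit.neg_iff]
      exact fun h => hx (isUnit_of_mul_isUnit_right h)
    obtain ⟨u, hu⟩ :=
      (IsLocalRing.isUnit_or_isUnit_of_add_one (neg_add_cancel_left (y * x) 1)).resolve_left hyx
    refine ⟨(↑u⁻¹ : R), ?_⟩
    have h : (↑u⁻¹ : R) * (y * x + 1) = 1 := by rw [← hu, Units.inv_mul]
    rw [Submodule.mem_bot, mul_assoc, ← mul_add_one, h, sub_self]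

theorem isUnit_one_sub_of_mem_jacobson [Finite R] [IsLocalRing R] {x : R}
    (hx : x ∈ Ideal.jacobson (⊥ : Ideal R)) : IsUnit (1 - x) :=
  (IsLocalRing.isUnit_or_isUnit_of_add_one (add_sub_cancel x 1)).resolve_left
    (mem_jacobson_bot_iff_not_isUnit.1 hx)

theorem isUnit_matrix_diag_one_iff (e : R) :
    IsUnit !![1, 0; 0, e] ↔ IsUnit e := by
  constructor
  · rintro ⟨M, hM⟩
    have h₁ := congr_fun₂ M.mul_inv 1 1
    have h₂ := congr_fun₂ M.inv_mul 1 1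
    rw [hM] at h₁ h₂
    simp [Matrix.mul_apply, Fin.sum_univ_two] at h₁ h₂
    exact ⟨⟨e, _, h₁, h₂⟩, rfl⟩
  · rintro ⟨u, rfl⟩
    refine ⟨⟨!![1, 0; 0, (u : R)], !![1, 0; 0, (↑u⁻¹ : R)], ?_, ?_⟩, rfl⟩ <;>
      simp [Matrix.one_fin_two]

theorem isUnit_matrix_lower (x : R) : IsUnit !![1, 0; x, 1] :=
  ⟨⟨!![1, 0; x, 1], !![1, 0; -x, 1], by simp [Matrix.one_fin_two],
    by simp [Matrix.one_fin_two]⟩, rfl⟩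

theorem isUnit_matrix_antidiag (x : R) : IsUnit !![x, 1; 1, 0] :=
  ⟨⟨!![x, 1; 1, 0], !![0, 1; 1, -x], by simp [Matrix.one_fin_two],
    by simp [Matrix.one_fin_two]⟩, rfl⟩

theorem isUnit_matrix_of_upper_right_one (a c d : R) :
    IsUnit !![a, 1; c, d] ↔ IsUnit (c - d * a) := by
  have h : !![a, 1; c, d] = !![1, 0; d, 1] * (!![1, 0; 0, c - d * a] * !![a, 1; 1, 0]) := by
    simp
  rw [h, (isUnit_matrix_lower d).mul_left_iff, (isUnit_matrix_antidiag a).mul_right_iff,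
    isUnit_matrix_diag_one_iff]

theorem isUnit_matrix_of_upper_left_one (b c d : R) :
    IsUnit !![1, b; c, d] ↔ IsUnit (d - c * b) := by
  have h : !![1, b; c, d] = !![b, 1; d, c] * !![0, 1; 1, 0] := by simp
  rw [h, (isUnit_matrix_antidiag 0).mul_right_iff, isUnit_matrix_of_upper_right_one]

theorem projAssoc_equivalence (R : Type*) [Ring R] : Equivalence (ProjAssoc R) where
  refl _ := ⟨1, by simp⟩
  symm := by
    rintro v w ⟨u, h₁, h₂⟩
    exact ⟨u⁻¹, by simp [h₁], by simp [h₂]⟩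
  trans := by
    rintro v w x ⟨u, h₁, h₂⟩ ⟨t, h₃, h₄⟩
    exact ⟨u * t, by simp [h₁, h₃, mul_assoc], by simp [h₂, h₄, mul_assoc]⟩

theorem ProjLine.mk_eq_mk_iff {v w : AdmissiblePair R} :
    ProjLine.mk R v = ProjLine.mk R w ↔ ProjAssoc R v w :=
  (projAssoc_equivalence R).quot_mk_eq_iff v w

theorem distant_mk_iff (v w : AdmissiblePair R) :
    Distant R (ProjLine.mk R v) (ProjLine.mk R w) ↔
      IsUnit !![v.1.1, v.1.2; w.1.1, w.1.2] := by
  constructor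
  · rintro ⟨a, b, c, d, h₁, h₂, hv, hw, h⟩
    obtain ⟨s, hs₁, hs₂⟩ := ProjLine.mk_eq_mk_iff.1 hv
    obtain ⟨t, ht₁, ht₂⟩ := ProjLine.mk_eq_mk_iff.1 hw
    have hst : IsUnit !![(s : R), 0; 0, (t : R)] :=
      ⟨⟨!![(s : R), 0; 0, (t : R)], !![(↑s⁻¹ : R), 0; 0, (↑t⁻¹ : R)],
        by simp [Matrix.one_fin_two], by simp [Matrix.one_fin_two]⟩, rfl⟩
    have hM : !![v.1.1, v.1.2; w.1.1, w.1.2] =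
        !![(s : R), 0; 0, (t : R)] * !![a, b; c, d] := by
      simp [hs₁, hs₂, ht₁, ht₂]
    rw [hM]
    exact hst.mul h
  · exact fun h => ⟨_, _, _, _, v.2, w.2, rfl, rfl, h⟩

theorem Admissible.isUnit_or_isUnit [Finite R] [IsLocalRing R] {v : R × R}
    (h : Admissible R v) : IsUnit v.1 ∨ IsUnit v.2 := by
  obtain ⟨M, ⟨N, rfl⟩, h₁, h₂⟩ := h
  have h := congr_fun₂ N.mul_inv 0 0
  rw [Matrix.mul_apply, Fin.sum_univ_two, h₁, h₂, Matrix.one_apply_eq] at h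
  exact (IsLocalRing.isUnit_or_isUnit_of_add_one h).imp
    isUnit_of_mul_isUnit_left isUnit_of_mul_isUnit_left

theorem admissible_mk_one (a : R) : Admissible R (a, 1) :=
  ⟨!![a, 1; 1, 0], isUnit_matrix_antidiag a, rfl, rfl⟩

theorem admissible_one_mk (b : R) : Admissible R (1, b) :=
  ⟨!![1, b; 0, 1], (isUnit_matrix_of_upper_left_one b 0 1).2 (by simp), rfl, rfl⟩

/-- The affine point with representative `(a, 1)`. -/
def ProjLine.affine (a : R) : ProjLine R :=
  ProjLine.mk R ⟨(a, 1), admissible_mk_one a⟩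

/-- The point with representative `(1, b)`. -/
def ProjLine.coaffine (b : R) : ProjLine R :=
  ProjLine.mk R ⟨(1, b), admissible_one_mk b⟩

theorem ProjLine.affine_injective : Function.Injective (ProjLine.affine (R := R)) := by
  intro a c h
  obtain ⟨u, h₁, h₂⟩ := ProjLine.mk_eq_mk_iff.1 h
  simp only [mul_one] at h₂
  simpa [← h₂] using h₁

theorem ProjLine.coaffine_injective : Function.Injective (ProjLine.coaffine (R := R)) := by
  intro a c h
  obtain ⟨u, h₁, h₂⟩ := ProjLine.mk_eq_mk_iff.1 h
  simp only [mul_one] at h₁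
  simpa [← h₁] using h₂

theorem ProjLine.affine_or_coaffine [Finite R] [IsLocalRing R] (x : ProjLine R) :
    (∃ a, x = affine a) ∨ ∃ b ∈ Ideal.jacobson (⊥ : Ideal R), x = coaffine b := by
  obtain ⟨⟨⟨a, b⟩, h⟩, rfl⟩ := Quot.exists_rep x
  by_cases hb : IsUnit b
  · obtain ⟨u, rfl⟩ := hb
    exact .inl ⟨↑u⁻¹ * a, ProjLine.mk_eq_mk_iff.2 ⟨u, by simp⟩⟩
  · obtain ⟨u, rfl⟩ := h.isUnit_or_isUnit.resolve_right hb
    refine .inr ⟨↑u⁻¹ * b, ?_, ProjLine.mk_eq_mk_iff.2 ⟨u, by simp⟩⟩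
    exact Ideal.mul_mem_left _ _ (mem_jacobson_bot_iff_not_isUnit.2 hb)

theorem distant_affine_affine [Finite R] [IsLocalRing R] (a c : R) :
    Distant R (.affine a) (.affine c) ↔ c - a ∉ Ideal.jacobson (⊥ : Ideal R) := by
  have h : Distant R (.affine a) (.affine c) ↔ IsUnit (c - 1 * a) :=
    (distant_mk_iff _ _).trans (isUnit_matrix_of_upper_right_one a c 1)
  rw [h, mem_jacobson_bot_iff_not_isUnit, not_not, one_mul]

theorem distant_affine_coaffine [Finite R] [IsLocalRing R] (a : R) {b : R}
    (hb : b ∈ Ideal.jacobson (⊥ : Ideal R)) : Distant R (.affine a) (.coaffine b) := by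
  refine ((distant_mk_iff _ _).trans (isUnit_matrix_of_upper_right_one a 1 b)).2 ?_
  refine isUnit_one_sub_of_mem_jacobson (mem_jacobson_bot_iff_not_isUnit.2 fun h => ?_)
  exact mem_jacobson_bot_iff_not_isUnit.1 hb (isUnit_of_mul_isUnit_left h)

theorem distant_coaffine_affine [Finite R] [IsLocalRing R] (a : R) {b : R}
    (hb : b ∈ Ideal.jacobson (⊥ : Ideal R)) : Distant R (.coaffine b) (.affine a) :=
  ((distant_mk_iff _ _).trans (isUnit_matrix_of_upper_left_one b a 1)).2
    (isUnit_one_sub_of_mem_jacobson (Ideal.mul_mem_left _ _ hb))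

theorem not_distant_coaffine_coaffine [Finite R] [IsLocalRing R] {b d : R}
    (hb : b ∈ Ideal.jacobson (⊥ : Ideal R)) (hd : d ∈ Ideal.jacobson (⊥ : Ideal R)) :
    ¬ Distant R (.coaffine b) (.coaffine d) := by
  have h : Distant R (.coaffine b) (.coaffine d) ↔ IsUnit (d - 1 * b) :=
    (distant_mk_iff _ _).trans (isUnit_matrix_of_upper_left_one b 1 d)
  rw [h, ← mem_jacobson_bot_iff_not_isUnit, one_mul]
  exact sub_mem hd hb

open Classical in
/-- The residue of a point: the class of `a` modulo the Jacobson radical for the affine point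
`(a, 1)`, and `none` for the points that are not affine. -/
noncomputable def ProjLine.residue (x : ProjLine R) :
    Option (R ⧸ (Ideal.jacobson (⊥ : Ideal R)).toAddSubgroup) :=
  if h : ∃ a, x = affine a then some (QuotientAddGroup.mk h.choose) else none

theorem ProjLine.residue_affine (a : R) :
    (affine a).residue = some (QuotientAddGroup.mk a) := by
  have h : ∃ c, affine a = affine c := ⟨a, rfl⟩
  rw [residue, dif_pos h, ← affine_injective h.choose_spec]

theorem ProjLine.residue_coaffine [Finite R] [IsLocalRing R] {b : R}
    (hb : b ∈ Ideal.jacobson (⊥ : Ideal R)) : (coaffine b).residue = none := by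
  refine dif_neg ?_
  rintro ⟨a, h⟩
  refine not_distant_coaffine_coaffine hb hb ?_
  nth_rewrite 2 [h]
  exact distant_coaffine_affine a hb

theorem ProjLine.residue_surjective [Finite R] [IsLocalRing R] :
    Function.Surjective (ProjLine.residue (R := R)) := by
  rintro (_ | q)
  · exact ⟨_, residue_coaffine (zero_mem _)⟩
  · obtain ⟨a, rfl⟩ := QuotientAddGroup.mk_surjective q
    exact ⟨_, residue_affine a⟩

theorem not_distant_iff_residue_eq [Finite R] [IsLocalRing R] (x y : ProjLine R) :
    ¬ Distant R x y ↔ x.residue = y.residue := by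
  obtain ⟨a, rfl⟩ | ⟨b, hb, rfl⟩ := x.affine_or_coaffine <;>
    obtain ⟨c, rfl⟩ | ⟨d, hd, rfl⟩ := y.affine_or_coaffine
  · rw [distant_affine_affine, not_not, ProjLine.residue_affine, ProjLine.residue_affine,
      Option.some_inj, QuotientAddGroup.eq, neg_add_eq_sub]
    rfl
  · simp [ProjLine.residue_affine, ProjLine.residue_coaffine hd, distant_affine_coaffine a hd]
  · simp [ProjLine.residue_affine, ProjLine.residue_coaffine hb, distant_coaffine_affine c hb]
  · simp [ProjLine.residue_coaffine hb, ProjLine.residue_coaffine hd,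
      not_distant_coaffine_coaffine hb hd]

theorem card_residue_fibre [Finite R] [IsLocalRing R] (x : ProjLine R) :
    Nat.card {y : ProjLine R | x.residue = y.residue} =
      Nat.card (Ideal.jacobson (⊥ : Ideal R)) := by
  obtain ⟨a, rfl⟩ | ⟨b, hb, rfl⟩ := x.affine_or_coaffine
  · have h : {y : ProjLine R | (ProjLine.affine a).residue = y.residue} =
        Set.range fun j : Ideal.jacobson (⊥ : Ideal R) => ProjLine.affine (a + j) := by
      ext y
      rw [Set.mem_ofPred_eq, Set.mem_range, ← not_distant_iff_residue_eq]
      constructor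
      · intro hy
        obtain ⟨c, rfl⟩ | ⟨d, hd, rfl⟩ := y.affine_or_coaffine
        · rw [distant_affine_affine, not_not] at hy
          exact ⟨⟨c - a, hy⟩, by simp⟩
        · exact absurd (distant_affine_coaffine a hd) hy
      · rintro ⟨j, rfl⟩
        simp [distant_affine_affine]
    rw [h]
    exact Nat.card_range_of_injective fun i j hij =>
      Subtype.ext (add_left_cancel (ProjLine.affine_injective hij))
  · have h : {y : ProjLine R | (ProjLine.coaffine b).residue = y.residue} =
        Set.range fun j : Ideal.jacobson (⊥ : Ideal R) => ProjLine.coaffine (j : R) := by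
      ext y
      rw [Set.mem_ofPred_eq, Set.mem_range, ← not_distant_iff_residue_eq]
      constructor
      · intro hy
        obtain ⟨c, rfl⟩ | ⟨d, hd, rfl⟩ := y.affine_or_coaffine
        · exact absurd (distant_coaffine_affine c hb) hy
        · exact ⟨⟨d, hd⟩, rfl⟩
      · rintro ⟨j, rfl⟩
        exact not_distant_coaffine_coaffine hb j.2
    rw [h]
    exact Nat.card_range_of_injective fun i j hij =>
      Subtype.ext (ProjLine.coaffine_injective hij)

end LocalRing

/-- For a finite local ring `R` with Jacobson radical `J`, the relation "equal or not
distant" on `P(R)` is an equivalence relation with `|R|/|J| + 1` classes, each of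
cardinality `|J|`. -/
theorem local_ring_neighbour_classes (R : Type*) [Ring R] [Fintype R] [IsLocalRing R] :
    Equivalence (fun x y : ProjLine R => x = y ∨ ¬ Distant R x y) ∧
    Nat.card (Quot (fun x y : ProjLine R => x = y ∨ ¬ Distant R x y)) =
      Nat.card R / Nat.card (Ideal.jacobson (⊥ : Ideal R)) + 1 ∧
    ∀ x : ProjLine R,
      Nat.card {y : ProjLine R | x = y ∨ ¬ Distant R x y} =
        Nat.card (Ideal.jacobson (⊥ : Ideal R)) := by
  have hrel (x y : ProjLine R) : (x = y ∨ ¬ Distant R x y) ↔ x.residue = y.residue := by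
    rw [not_distant_iff_residue_eq, or_iff_right_of_imp (congrArg _)]
  simp only [hrel]
  refine ⟨(Setoid.ker ProjLine.residue).iseqv, ?_, card_residue_fibre⟩
  have hquot := Nat.card_congr
    (Setoid.quotientKerEquivOfSurjective _ (ProjLine.residue_surjective (R := R)))
  rw [Finite.card_option] at hquot
  refine hquot.trans (congrArg (· + 1) ?_)
  rw [AddSubgroup.card_eq_card_quotient_mul_card_addSubgroup
    (Ideal.jacobson (⊥ : Ideal R)).toAddSubgroup]
  exact (Nat.mul_div_cancel _ Nat.card_pos).symm
end

section
/- Let ι be a nonempty finite index set, for each i ∈ ι let Rᵢ be a finite commutative local ring with Jacobson radical Jᵢ, and set qᵢ = |Rᵢ|/|Jᵢ|. Let R = ∏ᵢ Rᵢ. Then the clique number of the distant graph of R (the maximal size of a set of pairwise distant points of P(R)) equals (minᵢ qᵢ) + 1. -/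
/-- The slope `a / b` of the image of a point `(a, b)` over a field, with `none` for the
point at infinity. -/
noncomputable def ProjLine.slope {A k : Type*} [CommRing A] [Field k] (φ : A →+* k) :
    ProjLine A → Option k :=
  open Classical in
  Quot.lift (fun v => if φ v.1.2 = 0 then none else some (φ v.1.1 / φ v.1.2)) (by
    rintro v w ⟨u, h₁, h₂⟩
    have hu : φ u ≠ 0 := (u.isUnit.map φ).ne_zero
    by_cases hw : φ w.1.2 = 0 <;> simp [h₁, h₂, hu, hw, mul_div_mul_left])

theorem Distant.slope_ne {A k : Type*} [CommRing A] [Field k] (φ : A →+* k)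
    {x y : ProjLine A} (h : Distant A x y) : x.slope φ ≠ y.slope φ := by
  obtain ⟨a, b, c, d, h₁, h₂, rfl, rfl, hM⟩ := h
  rw [Matrix.isUnit_iff_isUnit_det, Matrix.det_fin_two_of] at hM
  have hdet := (hM.map φ).ne_zero
  simp only [map_sub, map_mul] at hdet
  simp only [ProjLine.slope, ProjLine.mk]
  split_ifs with hb hd hd
  · simp [hb, hd] at hdet
  · simp
  · simp
  · intro heq
    rw [Option.some.injEq, div_eq_div_iff hb hd] at heq
    exact hdet (by linear_combination heq)

theorem Distant.ne {A : Type*} [CommRing A] [Nontrivial A] {x y : ProjLine A}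
    (h : Distant A x y) : x ≠ y := by
  obtain ⟨m, hm⟩ := Ideal.exists_maximal A
  let := Ideal.Quotient.field m
  rintro rfl
  exact h.slope_ne (Ideal.Quotient.mk m) rfl

theorem card_le_of_pairwise_distant {A k : Type*} [CommRing A] [Field k] [Finite k]
    (φ : A →+* k) (S : Finset (ProjLine A)) (hS : ∀ x ∈ S, ∀ y ∈ S, x ≠ y → Distant A x y) :
    S.card ≤ Nat.card k + 1 := by
  classical
  have hinj : Function.Injective (fun x : S => x.1.slope φ) := by
    intro x y hxy
    by_contra hne
    exact (hS x x.2 y y.2 (fun h => hne (Subtype.ext h))).slope_ne φ hxy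
  have h := Nat.card_le_card_of_injective _ hinj
  rwa [Finite.card_option, Nat.card_eq_fintype_card, Fintype.card_coe] at h

theorem admissible_one_right {A : Type*} [CommRing A] (r : A) : Admissible A (r, 1) :=
  ⟨!![r, 1; 1, 0], by simp [Matrix.isUnit_iff_isUnit_det, Matrix.det_fin_two_of], rfl, rfl⟩

theorem admissible_one_zero {A : Type*} [CommRing A] : Admissible A ((1 : A), (0 : A)) :=
  ⟨!![1, 0; 0, 1], by simp [Matrix.isUnit_iff_isUnit_det, Matrix.det_fin_two_of], rfl, rfl⟩

/-- The affine point `(r, 1)` for `some r` and the point at infinity `(1, 0)` for `none`. -/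
def ProjLine.ofOption {A : Type*} [CommRing A] : Option A → ProjLine A
  | none => ProjLine.mk A ⟨(1, 0), admissible_one_zero⟩
  | some r => ProjLine.mk A ⟨(r, 1), admissible_one_right r⟩

theorem exists_clique_of_isUnit_sub {A : Type*} [CommRing A] [Nontrivial A] {m : ℕ}
    (r : Fin m → A) (hr : ∀ s t, s ≠ t → IsUnit (r s - r t)) :
    ∃ S : Finset (ProjLine A), S.card = m + 1 ∧
      ∀ x ∈ S, ∀ y ∈ S, x ≠ y → Distant A x y := by
  classical
  have hf : ∀ s t : Option (Fin m), s ≠ t →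
      Distant A (ProjLine.ofOption (s.map r)) (ProjLine.ofOption (t.map r)) := by
    rintro (_ | s) (_ | t) hst
    · exact absurd rfl hst
    · exact ⟨1, 0, r t, 1, admissible_one_zero, admissible_one_right _, rfl, rfl,
        by simp [Matrix.isUnit_iff_isUnit_det, Matrix.det_fin_two_of]⟩
    · exact ⟨r s, 1, 1, 0, admissible_one_right _, admissible_one_zero, rfl, rfl,
        by simp [Matrix.isUnit_iff_isUnit_det, Matrix.det_fin_two_of]⟩
    · exact ⟨r s, 1, r t, 1, admissible_one_right _, admissible_one_right _, rfl, rfl,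
        by simpa [Matrix.isUnit_iff_isUnit_det, Matrix.det_fin_two_of]
          using hr s t (fun h => hst (congrArg some h))⟩
  have hinj : Function.Injective (fun s : Option (Fin m) => ProjLine.ofOption (s.map r)) := by
    intro s t hst
    by_contra hne
    exact (hf s t hne).ne hst
  refine ⟨Finset.univ.image (fun s : Option (Fin m) => ProjLine.ofOption (s.map r)), ?_, ?_⟩
  · rw [Finset.card_image_of_injective _ hinj]
    simp
  · intro x hx y hy hxy
    obtain ⟨s, -, rfl⟩ := Finset.mem_image.mp hx
    obtain ⟨t, -, rfl⟩ := Finset.mem_image.mp hy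
    exact hf s t (fun h => hxy (by rw [h]))

theorem IsLocalRing.card_residueField_eq_div {A : Type*} [CommRing A] [Finite A]
    [IsLocalRing A] :
    Nat.card (IsLocalRing.ResidueField A) =
      Nat.card A / Nat.card (Ideal.jacobson (⊥ : Ideal A)) := by
  rw [IsLocalRing.jacobson_eq_maximalIdeal ⊥ bot_ne_top,
    Submodule.card_eq_card_quotient_mul_card (IsLocalRing.maximalIdeal A)]
  exact (Nat.mul_div_cancel_left _ Nat.card_pos).symm

theorem IsLocalRing.exists_isUnit_sub {A : Type*} [CommRing A] [Finite A] [IsLocalRing A]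
    {m : ℕ} (hm : m ≤ Nat.card (IsLocalRing.ResidueField A)) :
    ∃ r : Fin m → A, ∀ s t, s ≠ t → IsUnit (r s - r t) := by
  have : Finite (IsLocalRing.ResidueField A) := Finite.of_surjective _ residue_surjective
  let e := Finite.equivFin (IsLocalRing.ResidueField A)
  choose g hg using residue_surjective (R := A)
  refine ⟨fun s => g (e.symm (Fin.castLE hm s)), fun s t hst => ?_⟩
  rw [← residue_ne_zero_iff_isUnit, map_sub, hg, hg, sub_ne_zero]
  simpa using hst

/-- The clique number of the distant graph of a finite direct product of finite
commutative local rings is `(minᵢ qᵢ) + 1`. -/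
theorem clique_number_comm (ι : Type*) [Fintype ι] [Nonempty ι] (R : ι → Type*)
    [∀ i, CommRing (R i)] [∀ i, Fintype (R i)] [∀ i, IsLocalRing (R i)]
    (J : ∀ i, Ideal (R i)) (hJ : ∀ i, J i = Ideal.jacobson (⊥ : Ideal (R i)))
    (q : ι → ℕ) (hq : ∀ i, q i = Nat.card (R i) / Nat.card (J i)) :
    IsGreatest {n : ℕ | ∃ S : Finset (ProjLine (∀ i, R i)),
        S.card = n ∧ ∀ x ∈ S, ∀ y ∈ S, x ≠ y → Distant (∀ i, R i) x y}
      ((⨅ i, q i) + 1) := by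
  have hq' : ∀ i, q i = Nat.card (IsLocalRing.ResidueField (R i)) := fun i => by
    rw [hq, hJ, IsLocalRing.card_residueField_eq_div]
  have : Nontrivial (∀ i, R i) := Pi.nontrivial_at (Classical.arbitrary ι)
  constructor
  · choose r hr using fun i => IsLocalRing.exists_isUnit_sub
      ((ciInf_le' q i).trans (hq' i).le)
    exact exists_clique_of_isUnit_sub (fun s i => r i s)
      fun s t hst => Pi.isUnit_iff.mpr fun i => hr i s t hst
  · rintro n ⟨S, rfl, hS⟩
    obtain ⟨i, hi⟩ := exists_eq_ciInf_of_finite (f := q)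
    have : Finite (IsLocalRing.ResidueField (R i)) :=
      Finite.of_surjective _ IsLocalRing.residue_surjective
    rw [← hi, hq']
    exact card_le_of_pairwise_distant
      ((IsLocalRing.residue (R i)).comp (Pi.evalRingHom R i)) S hS
end

section
/- Let h ≥ k ≥ 1 be natural numbers. There is a bijection f from D₂(h,k) to the disjoint union of D₂(h−k,k) and D₂(h−k,k−1) such that: if f(x) lies in D₂(h−k,k) then f(x) has the same total number of parts as x, and if f(x) lies in D₂(h−k,k−1) then f(x) has exactly one part fewer than x. -/
/-- A `2`-distinct partition of `h` whose first constituent has exactly `k` parts: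
a pair of partitions `(A, B)`, each with pairwise distinct parts, the numbers they
partition summing to `h`, and `A` having exactly `k` parts. -/
structure D2 (h k : ℕ) where
  /-- the number partitioned by the first constituent -/
  a : ℕ
  /-- the number partitioned by the second constituent -/
  b : ℕ
  /-- the first constituent partition -/
  A : Nat.Partition a
  /-- the second constituent partition -/
  B : Nat.Partition b
  sum_eq : a + b = h
  A_distinct : A.parts.Nodup
  B_distinct : B.parts.Nodup
  A_card : A.parts.card = k

/-- The total number of parts of a `2`-distinct partition. -/
def D2.totalParts {h k : ℕ} (x : D2 h k) : ℕ := x.A.parts.card + x.B.parts.card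

namespace D2

theorem ext_parts {h k : ℕ} {x y : D2 h k} (hA : x.A.parts = y.A.parts)
    (hB : x.B.parts = y.B.parts) : x = y := by
  obtain ⟨a, b, ⟨s, hs, hsa⟩, ⟨t, ht, htb⟩, _, _, _, _⟩ := x
  obtain ⟨a', b', ⟨s', hs', hsa'⟩, ⟨t', ht', htb'⟩, _, _, _, _⟩ := y
  dsimp only at hA hB
  subst hA hB hsa hsa' htb htb'
  rfl

/-- Replace the first constituent of a `2`-distinct partition by the partition with parts `s`. -/
def replaceFst {h k h' k' : ℕ} (x : D2 h k) (s : Multiset ℕ) (pos : ∀ i ∈ s, 0 < i)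
    (nodup : s.Nodup) (card : s.card = k') (sum : s.sum + x.b = h') : D2 h' k' where
  a := s.sum
  b := x.b
  A := ⟨s, fun {i} => pos i, rfl⟩
  B := x.B
  sum_eq := sum
  A_distinct := nodup
  B_distinct := x.B_distinct
  A_card := card

theorem sum_map_succ (s : Multiset ℕ) : (s.map Nat.succ).sum = s.sum + s.card := by
  simp [Nat.succ_eq_add_one, Multiset.sum_map_add]

theorem map_succ_map_pred {s : Multiset ℕ} (hs : ∀ i ∈ s, 0 < i) :
    (s.map Nat.pred).map Nat.succ = s := by
  rw [Multiset.map_map]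
  conv_rhs => rw [← Multiset.map_id s]
  exact Multiset.map_congr rfl fun i hi => Nat.succ_pred_eq_of_pos (hs i hi)

theorem exists_map_succ {s : Multiset ℕ} (hs : ∀ i ∈ s, 1 < i) (nodup : s.Nodup) :
    ∃ t : Multiset ℕ, t.map Nat.succ = s ∧ (∀ i ∈ t, 0 < i) ∧ t.Nodup := by
  have e := map_succ_map_pred fun i hi => zero_lt_one.trans (hs i hi)
  refine ⟨s.map Nat.pred, e, fun i hi => ?_, Multiset.Nodup.of_map Nat.succ (by rwa [e])⟩
  obtain ⟨j, hj, rfl⟩ := Multiset.mem_map.1 hi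
  exact Nat.sub_pos_of_lt (hs j hj)

theorem zero_notMem {h k : ℕ} (x : D2 h k) : 0 ∉ x.A.parts :=
  fun hx => (x.A.parts_pos hx).ne rfl

theorem one_notMem_map_succ {h k : ℕ} (x : D2 h k) : 1 ∉ x.A.parts.map Nat.succ := by
  simpa using x.zero_notMem

/-- Increase every part of the first constituent by one. -/
def shift {h k : ℕ} (hkh : k ≤ h) (y : D2 (h - k) k) : D2 h k :=
  y.replaceFst (y.A.parts.map Nat.succ) (by simp)
    (y.A_distinct.map Nat.succ_injective) (by simp [y.A_card]) (by
      have := y.sum_eq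
      rw [sum_map_succ, y.A.parts_sum, y.A_card]
      omega)

/-- Increase every part of the first constituent by one and add a part equal to one. -/
def shiftCons {h k : ℕ} (hk1 : 1 ≤ k) (hkh : k ≤ h) (y : D2 (h - k) (k - 1)) : D2 h k :=
  y.replaceFst (1 ::ₘ y.A.parts.map Nat.succ) (by simp)
    (Multiset.nodup_cons.2 ⟨y.one_notMem_map_succ, y.A_distinct.map Nat.succ_injective⟩)
    (by simp only [Multiset.card_cons, Multiset.card_map, y.A_card]; omega) (by
      have := y.sum_eq
      rw [Multiset.sum_cons, sum_map_succ, y.A.parts_sum, y.A_card]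
      omega)

theorem bijective_elim_shift {h k : ℕ} (hk1 : 1 ≤ k) (hkh : k ≤ h) :
    Function.Bijective (Sum.elim (shift hkh) (shiftCons hk1 hkh)) := by
  constructor
  · apply Function.Injective.sumElim
    · intro y z e
      have hA : y.A.parts.map Nat.succ = z.A.parts.map Nat.succ :=
        congrArg (fun x : D2 h k => x.A.parts) e
      exact ext_parts (Multiset.map_injective Nat.succ_injective hA)
        (congrArg (fun x : D2 h k => x.B.parts) e)
    · intro y z e
      have hA : 1 ::ₘ y.A.parts.map Nat.succ = 1 ::ₘ z.A.parts.map Nat.succ :=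
        congrArg (fun x : D2 h k => x.A.parts) e
      exact ext_parts (Multiset.map_injective Nat.succ_injective ((Multiset.cons_inj_right 1).1 hA))
        (congrArg (fun x : D2 h k => x.B.parts) e)
    · intro y z e
      have hA : y.A.parts.map Nat.succ = 1 ::ₘ z.A.parts.map Nat.succ :=
        congrArg (fun x : D2 h k => x.A.parts) e
      exact y.one_notMem_map_succ (hA ▸ Multiset.mem_cons_self 1 _)
  · intro x
    have hsum := x.sum_eq
    rw [← x.A.parts_sum] at hsum
    have hcard := x.A_card
    by_cases h1 : 1 ∈ x.A.parts
    · obtain ⟨s, hs⟩ := Multiset.exists_cons_of_mem h1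
      have hd := Multiset.nodup_cons.1 (hs ▸ x.A_distinct)
      obtain ⟨t, rfl, pos, nodup⟩ := exists_map_succ (s := s) (fun i hi =>
        lt_of_le_of_ne (x.A.parts_pos (hs ▸ Multiset.mem_cons_of_mem hi))
          fun e => hd.1 (e ▸ hi)) hd.2
      rw [hs, Multiset.sum_cons, sum_map_succ] at hsum
      rw [hs, Multiset.card_cons, Multiset.card_map] at hcard
      exact ⟨Sum.inr (x.replaceFst t pos nodup (by omega) (by omega)), ext_parts hs.symm rfl⟩
    · obtain ⟨t, ht, pos, nodup⟩ := exists_map_succ (fun i hi =>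
        lt_of_le_of_ne (x.A.parts_pos hi) fun e => h1 (e ▸ hi)) x.A_distinct
      rw [← ht, sum_map_succ] at hsum
      rw [← ht, Multiset.card_map] at hcard
      exact ⟨Sum.inl (x.replaceFst t pos nodup hcard (by omega)), ext_parts ht rfl⟩

end D2

/-- For `1 ≤ k ≤ h` there is a bijection from `D₂(h,k)` to `D₂(h−k,k) ⊔ D₂(h−k,k−1)`
preserving the total number of parts on the first summand and decreasing it by one on the
second. -/
theorem d2_bijection (h k : ℕ) (hk1 : 1 ≤ k) (hkh : k ≤ h) :
    ∃ f : D2 h k ≃ (D2 (h - k) k ⊕ D2 (h - k) (k - 1)),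
      (∀ (x : D2 h k) (y : D2 (h - k) k),
        f x = Sum.inl y → y.totalParts = x.totalParts) ∧
      (∀ (x : D2 h k) (y : D2 (h - k) (k - 1)),
        f x = Sum.inr y → y.totalParts + 1 = x.totalParts) := by
  refine ⟨(Equiv.ofBijective _ (D2.bijective_elim_shift hk1 hkh)).symm, ?_, ?_⟩
  · intro x y e
    rw [Equiv.symm_apply_eq] at e
    subst e
    simp [D2.totalParts, D2.shift, D2.replaceFst]
  · intro x y e
    rw [Equiv.symm_apply_eq] at e
    subst e
    simp [D2.totalParts, D2.shiftCons, D2.replaceFst]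
    omega
end
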